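/- arXiv:2602.11031 — 5 statements merged into one kernel-verified Lean document; each statement's English description precedes it below -/
import Mathlib

section
/- For every integer n with n ∉ {0, 1, -1}, the assignment sending the generator a to the matrix [[1,1],[0,1]] and the generator t to the matrix [[n,0],[0,1]] extends to a group homomorphism from BS(1,n) into GL₂(ℚ), and this homomorphism is injective. In particular, BS(1,n) is a linear group. -/
/-- The defining relator set of the Baumslag–Solitar group `BS(1,n)`:
generators `false ↦ a`, `true ↦ t`, relator `t⁻¹ aⁿ t a⁻¹`. -/
def bsRels (n : ℤ) : Set (FreeGroup Bool) :=
  {(FreeGroup.of true)⁻¹ * (FreeGroup.of false) ^ n * FreeGroup.of true * (FreeGroup.of false)⁻¹}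

/-- The solvable Baumslag–Solitar group `BS(1,n) = ⟨a, t ∣ t⁻¹ aⁿ t = a⟩`. -/
abbrev BS (n : ℤ) := PresentedGroup (bsRels n)

/-- The generator `a` of `BS(1,n)`. -/
def BS.a (n : ℤ) : BS n := PresentedGroup.of false

/-- The generator `t` of `BS(1,n)`. -/
def BS.t (n : ℤ) : BS n := PresentedGroup.of true

/-- `ℤ[1/n]` as a set of rationals: those of the form `k / n^p`. -/
def zInv (n : ℤ) : Set ℚ := {x : ℚ | ∃ (k : ℤ) (p : ℕ), x = (k : ℚ) / (n : ℚ) ^ p}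

open Classical in
/-- For `α = k/n^p ∈ ℤ[1/n]`, the element `a^α := t⁻ᵖ aᵏ tᵖ` of `BS(1,n)`
(junk value `1` if `α ∉ ℤ[1/n]`). -/
noncomputable def apow (n : ℤ) (α : ℚ) : BS n :=
  if h : ∃ kp : ℤ × ℕ, α = (kp.1 : ℚ) / (n : ℚ) ^ kp.2 then
    BS.t n ^ (-(h.choose.2 : ℤ)) * BS.a n ^ h.choose.1 * BS.t n ^ (h.choose.2 : ℤ)
  else 1

/-- `u` and `v` are `ψ`-twisted conjugate: `v = ψ(x)⁻¹ u x` for some `x`. -/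
def twistedConj {G : Type*} [Group G] (ψ : G →* G) (u v : G) : Prop :=
  ∃ x : G, v = (ψ x)⁻¹ * u * x

theorem BS.semiconjBy_t (n k : ℤ) : SemiconjBy (BS.t n) (BS.a n ^ k) (BS.a n ^ (n * k)) := by
  have hrel : (BS.t n)⁻¹ * BS.a n ^ n * BS.t n * (BS.a n)⁻¹ = 1 :=
    PresentedGroup.one_of_mem (rels := bsRels n) rfl
  have h : SemiconjBy (BS.t n) (BS.a n) (BS.a n ^ n) := by
    rw [mul_inv_eq_one, mul_assoc, inv_mul_eq_iff_eq_mul] at hrel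
    exact hrel.symm
  rw [zpow_mul]
  exact h.zpow_right k

theorem BS.semiconjBy_t_pow (n k : ℤ) (q : ℕ) :
    SemiconjBy (BS.t n ^ q) (BS.a n ^ k) (BS.a n ^ (n ^ q * k)) := by
  induction q with
  | zero => simp
  | succ q ih =>
    rw [pow_succ', pow_succ', mul_assoc n]
    exact (BS.semiconjBy_t n _).mul_left ih

/-- Every element of `BS(1,n)` has the form `t⁻ᵖ aᵏ t^q` with `p, q` natural numbers. -/
theorem BS.exists_eq_inv_pow_mul_zpow_mul_pow (n : ℤ) (x : BS n) :
    ∃ (p q : ℕ) (k : ℤ), x = (BS.t n ^ p)⁻¹ * BS.a n ^ k * BS.t n ^ q := by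
  have hx : x ∈ Subgroup.closure (Set.range (PresentedGroup.of (rels := bsRels n))) := by
    rw [PresentedGroup.closure_range_of]
    trivial
  have mul_a_zpow (p q : ℕ) (k l : ℤ) :
      (BS.t n ^ p)⁻¹ * BS.a n ^ k * BS.t n ^ q * BS.a n ^ l =
        (BS.t n ^ p)⁻¹ * BS.a n ^ (k + n ^ q * l) * BS.t n ^ q := by
    rw [mul_assoc _ (BS.t n ^ q), (BS.semiconjBy_t_pow n l q).eq, zpow_add]
    simp only [mul_assoc]
  induction hx using Subgroup.closure_induction_right with
  | one => exact ⟨0, 0, 0, by simp⟩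
  | mul_right x _ y hy ih =>
    obtain ⟨p, q, k, rfl⟩ := ih
    obtain ⟨_ | _, rfl⟩ := hy
    · exact ⟨p, q, k + n ^ q * 1, by rw [← mul_a_zpow, zpow_one]; rfl⟩
    · exact ⟨p, q + 1, k, by rw [pow_succ, ← mul_assoc]; rfl⟩
  | mul_inv_cancel x _ y hy ih =>
    obtain ⟨p, q, k, rfl⟩ := ih
    obtain ⟨_ | _, rfl⟩ := hy
    · exact ⟨p, q, k + n ^ q * (-1), by rw [← mul_a_zpow, zpow_neg_one]; rfl⟩
    · refine ⟨p + 1, q, n * k, ?_⟩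
      change _ * (BS.t n)⁻¹ = _
      have h : BS.a n ^ (n * k) = BS.t n * BS.a n ^ k * (BS.t n)⁻¹ :=
        eq_mul_inv_of_mul_eq (BS.semiconjBy_t n k).eq.symm
      rw [h]
      group

/-- the assignment a ↦ [[1,1],[0,1]], t ↦ [[n,0],[0,1]] extends to a group
homomorphism BS(1,n) → GL₂(ℚ), and this homomorphism is injective. -/
theorem bs_linear (n : ℤ) (hn : n ∉ ({0, 1, -1} : Set ℤ)) :
    ∃ φ : BS n →* GL (Fin 2) ℚ,
      ((φ (BS.a n) : Matrix (Fin 2) (Fin 2) ℚ) = !![1, 1; 0, 1]) ∧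
      ((φ (BS.t n) : Matrix (Fin 2) (Fin 2) ℚ) = !![(n : ℚ), 0; 0, 1]) ∧
      Function.Injective φ := by
  simp only [Set.mem_insert_iff, Set.mem_singleton_iff, not_or] at hn
  obtain ⟨hn0, hn1, hn2⟩ := hn
  have hnQ : (n : ℚ) ≠ 0 := by exact_mod_cast hn0
  let A : GL (Fin 2) ℚ := Matrix.GeneralLinearGroup.mkOfDetNeZero !![1, 1; 0, 1] (by simp)
  let T : GL (Fin 2) ℚ := Matrix.GeneralLinearGroup.mkOfDetNeZero !![(n : ℚ), 0; 0, 1] (by simpa)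
  have hA (k : ℤ) :
      ((A ^ k : GL (Fin 2) ℚ) : Matrix (Fin 2) (Fin 2) ℚ) = !![1, (k : ℚ); 0, 1] := by
    have h : A = Matrix.GeneralLinearGroup.upperRightHom 1 := by
      ext i j
      fin_cases i <;> fin_cases j <;> rfl
    rw [h, ← AddChar.map_zsmul_eq_zpow]
    simp
  have hT (q : ℕ) : ((T ^ q : GL (Fin 2) ℚ) : Matrix (Fin 2) (Fin 2) ℚ) =
      !![(n : ℚ) ^ q, 0; 0, 1] := by
    induction q with
    | zero => simp [Matrix.one_fin_two]
    | succ q ih =>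
      rw [pow_succ, Units.val_mul, ih]
      simp [T, Matrix.GeneralLinearGroup.mkOfDetNeZero, pow_succ]
  have hrel : ∀ r ∈ bsRels n, FreeGroup.lift (fun b : Bool ↦ if b then T else A) r = 1 := by
    rintro _ rfl
    simp only [map_mul, map_inv, map_zpow, FreeGroup.lift_apply_of, if_true, Bool.false_eq_true,
      if_false]
    rw [mul_inv_eq_one, mul_assoc, inv_mul_eq_iff_eq_mul, ← zpow_one A, ← zpow_mul, ← pow_one T,
      Units.ext_iff, Units.val_mul, Units.val_mul, hA, hT, hA]
    simp
  let φ : BS n →* GL (Fin 2) ℚ := PresentedGroup.toGroup hrel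
  have hφa : φ (BS.a n) = A := PresentedGroup.toGroup.of hrel
  have hφt : φ (BS.t n) = T := PresentedGroup.toGroup.of hrel
  refine ⟨φ, by rw [hφa]; rfl, by rw [hφt]; rfl, (injective_iff_map_eq_one φ).mpr fun x hx ↦ ?_⟩
  obtain ⟨p, q, k, rfl⟩ := BS.exists_eq_inv_pow_mul_zpow_mul_pow n x
  rw [map_mul, map_mul, map_inv, map_pow, map_pow, map_zpow, hφa, hφt, mul_assoc,
    inv_mul_eq_one, Units.ext_iff, Units.val_mul, hA, hT, hT] at hx
  have hpq : (n : ℚ) ^ p = (n : ℚ) ^ q := by simpa using congr_fun₂ hx 0 0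
  have hk : k = 0 := by simpa [eq_comm] using congr_fun₂ hx 0 1
  have h : p = q := Int.pow_right_injective (a := n) (by omega) (by exact_mod_cast hpq)
  simp [hk, h]
end

section
/- For every integer n with n ∉ {0, 1, -1}, the group BS(1,n) is isomorphic to the semidirect product ℤ[1/n] ⋊ ℤ, where c ∈ ℤ acts on the additive group ℤ[1/n] by multiplication by nᶜ, via an isomorphism sending a to (1, 0) and t to (0, 1). In particular, the kernel of the homomorphism π : BS(1,n) → ℤ sending a ↦ 0 and t ↦ 1 is isomorphic to the additive group ℤ[1/n]. -/
/-- `ℤ[1/n]` as an additive subgroup of `ℚ` (for `n ≠ 0`). -/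
def zSub (n : ℤ) (hn : n ≠ 0) : AddSubgroup ℚ where
  carrier := zInv n
  zero_mem' := ⟨0, 0, by norm_num⟩
  add_mem' := by
    rintro x y ⟨k₁, p₁, rfl⟩ ⟨k₂, p₂, rfl⟩
    refine ⟨k₁ * n ^ p₂ + k₂ * n ^ p₁, p₁ + p₂, ?_⟩
    have h : (n : ℚ) ≠ 0 := Int.cast_ne_zero.mpr hn
    have hp₁ : ((n : ℚ)) ^ p₁ ≠ 0 := pow_ne_zero _ h
    have hp₂ : ((n : ℚ)) ^ p₂ ≠ 0 := pow_ne_zero _ h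
    push_cast
    rw [div_add_div _ _ hp₁ hp₂, pow_add]
    ring_nf
  neg_mem' := by
    rintro x ⟨k, p, rfl⟩
    refine ⟨-k, p, ?_⟩
    push_cast
    ring

namespace BS

theorem t_mul_a_mul_t_inv (n : ℤ) : t n * a n * (t n)⁻¹ = a n ^ n := by
  have h : (t n)⁻¹ * a n ^ n * t n * (a n)⁻¹ = 1 :=
    PresentedGroup.one_of_mem (rels := bsRels n) rfl
  have h' : (t n)⁻¹ * a n ^ n * t n = a n := mul_inv_eq_one.mp h
  nth_rewrite 1 [← h']
  group

theorem t_mul_a_zpow (n k : ℤ) : t n * a n ^ k = a n ^ (n * k) * t n := by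
  rw [zpow_mul, ← t_mul_a_mul_t_inv, conj_zpow]
  group

theorem t_pow_mul_a_zpow (n k : ℤ) (p : ℕ) :
    t n ^ p * a n ^ k = a n ^ (n ^ p * k) * t n ^ p := by
  induction p with
  | zero => simp
  | succ p ih =>
    rw [pow_succ', mul_assoc, ih, ← mul_assoc, t_mul_a_zpow, mul_assoc, pow_succ', mul_assoc]

theorem a_zpow_mul_t_pow_inv (n k : ℤ) (p : ℕ) :
    a n ^ k * (t n ^ p)⁻¹ = (t n ^ p)⁻¹ * a n ^ (n ^ p * k) := by
  rw [mul_inv_eq_iff_eq_mul, mul_assoc, ← t_pow_mul_a_zpow, inv_mul_cancel_left]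

/-- Every element of `BS(1,n)` has the form `t⁻ᵖ aᵏ tᵐ` with `p ≥ 0`. -/
theorem exists_normal_form (n : ℤ) (g : BS n) :
    ∃ (p : ℕ) (k m : ℤ), g = (t n ^ p)⁻¹ * a n ^ k * t n ^ m := by
  have a_zpow_mul (j : ℤ) (p : ℕ) (k m : ℤ) :
      a n ^ j * ((t n ^ p)⁻¹ * a n ^ k * t n ^ m) =
        (t n ^ p)⁻¹ * a n ^ (n ^ p * j + k) * t n ^ m := by
    rw [← mul_assoc, ← mul_assoc, a_zpow_mul_t_pow_inv, mul_assoc ((t n ^ p)⁻¹), ← zpow_add]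
  have hg : g ∈ Subgroup.closure (Set.range (PresentedGroup.of (rels := bsRels n))) := by
    rw [PresentedGroup.closure_range_of]
    exact Subgroup.mem_top g
  induction hg using Subgroup.closure_induction_left with
  | one => exact ⟨0, 0, 0, by simp⟩
  | mul_left x hx y _ ih =>
    obtain ⟨p, k, m, rfl⟩ := ih
    obtain ⟨b, rfl⟩ := hx
    cases b
    · refine ⟨p, n ^ p * 1 + k, m, ?_⟩
      rw [← a_zpow_mul, zpow_one]
      rfl
    · change ∃ p' k' m', t n * _ = _
      cases p with
      | zero =>
        refine ⟨0, n * k, 1 + m, ?_⟩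
        rw [zpow_add, zpow_one, pow_zero, inv_one, one_mul, one_mul, ← mul_assoc,
          t_mul_a_zpow, mul_assoc]
      | succ p =>
        refine ⟨p, k, m, ?_⟩
        rw [pow_succ]
        group
  | inv_mul_cancel x hx y _ ih =>
    obtain ⟨p, k, m, rfl⟩ := ih
    obtain ⟨b, rfl⟩ := hx
    cases b
    · refine ⟨p, n ^ p * (-1) + k, m, ?_⟩
      rw [← a_zpow_mul, zpow_neg_one]
      rfl
    · refine ⟨p + 1, k, m, ?_⟩
      change (t n)⁻¹ * _ = _
      rw [pow_succ, mul_inv_rev]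
      simp only [mul_assoc]

end BS

/-- If an automorphism action `φ` of `ℤ` on `N` satisfies `φ(1)(x) = xⁿ`, this is the homomorphism
`BS(1,n) → N ⋊ ℤ` sending `a` to `(x, 0)` and `t` to `(0, 1)`. -/
def bsToSemidirect {N : Type*} [Group N] (n : ℤ) (φ : Multiplicative ℤ →* MulAut N) (x : N)
    (hx : φ (Multiplicative.ofAdd 1) x = x ^ n) :
    BS n →* SemidirectProduct N (Multiplicative ℤ) φ :=
  PresentedGroup.toGroup
    (f := fun b => cond b (SemidirectProduct.inr (Multiplicative.ofAdd 1))
      (SemidirectProduct.inl x)) (by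
    rintro r rfl
    simp only [map_mul, map_inv, map_zpow, FreeGroup.lift_apply_of, cond_true, cond_false]
    rw [mul_inv_eq_one, mul_assoc, inv_mul_eq_iff_eq_mul, ← map_zpow, ← hx,
      SemidirectProduct.inl_aut, map_inv, inv_mul_cancel_right])

section

variable {N : Type*} [Group N] (n : ℤ) (φ : Multiplicative ℤ →* MulAut N) (x : N)
  (hx : φ (Multiplicative.ofAdd 1) x = x ^ n)

@[simp]
theorem bsToSemidirect_a : bsToSemidirect n φ x hx (BS.a n) = SemidirectProduct.inl x :=
  PresentedGroup.toGroup.of _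

@[simp]
theorem bsToSemidirect_t : bsToSemidirect n φ x hx (BS.t n) =
    SemidirectProduct.inr (Multiplicative.ofAdd 1) :=
  PresentedGroup.toGroup.of _

theorem bsToSemidirect_normal_form (p : ℕ) (k m : ℤ) :
    bsToSemidirect n φ x hx ((BS.t n ^ p)⁻¹ * BS.a n ^ k * BS.t n ^ m) =
      ⟨φ (Multiplicative.ofAdd (-(p : ℤ))) (x ^ k), Multiplicative.ofAdd (m - p)⟩ := by
  have hp : (Multiplicative.ofAdd (1 : ℤ) ^ p)⁻¹ = Multiplicative.ofAdd (-(p : ℤ)) := by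
    rw [← ofAdd_nsmul, ← ofAdd_neg]; simp
  have hm : Multiplicative.ofAdd (1 : ℤ) ^ m = Multiplicative.ofAdd m := by
    rw [← ofAdd_zsmul]; simp
  simp only [map_mul, map_inv, map_pow, map_zpow, bsToSemidirect_a, bsToSemidirect_t]
  rw [← map_pow, ← map_zpow SemidirectProduct.inl, ← map_zpow SemidirectProduct.inr, ← map_inv,
    hp, hm, ← map_zpow (φ (Multiplicative.ofAdd (-(p : ℤ))))]
  generalize x ^ k = y
  ext
  · simp
  · simp [sub_eq_neg_add]

theorem bsToSemidirect_injective (h : ∀ k : ℤ, x ^ k = 1 → k = 0) :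
    Function.Injective (bsToSemidirect n φ x hx) := by
  rw [injective_iff_map_eq_one]
  intro g hg
  obtain ⟨p, k, m, rfl⟩ := BS.exists_normal_form n g
  rw [bsToSemidirect_normal_form, SemidirectProduct.ext_iff] at hg
  obtain ⟨hl, hr⟩ := hg
  have hk : k = 0 := h k ((map_eq_one_iff _ (MulEquiv.injective _)).mp hl)
  have hm : m - p = 0 := hr
  obtain rfl : m = p := by omega
  simp [hk]

theorem bsToSemidirect_surjective
    (h : ∀ y : N, ∃ (p : ℕ) (k : ℤ), y = φ (Multiplicative.ofAdd (-(p : ℤ))) (x ^ k)) :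
    Function.Surjective (bsToSemidirect n φ x hx) := by
  rintro ⟨y, c⟩
  obtain ⟨p, k, rfl⟩ := h y
  refine ⟨(BS.t n ^ p)⁻¹ * BS.a n ^ k * BS.t n ^ (c.toAdd + p), ?_⟩
  rw [bsToSemidirect_normal_form]
  simp

end

/-- If `e : G ≃* N ⋊ H` and `π : G → H` corresponds under `e` to the projection onto `H`, then
`N` is isomorphic to the kernel of `π`. -/
theorem SemidirectProduct.nonempty_ker_mulEquiv {G N H : Type*} [Group G] [Group N] [Group H]
    {φ : H →* MulAut N} (e : G ≃* SemidirectProduct N H φ) (π : G →* H)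
    (h : ∀ g, π g = (e g).right) : Nonempty (π.ker ≃* N) := by
  have hmem (y : N) : (e.symm.toMonoidHom.comp SemidirectProduct.inl) y ∈ π.ker := by
    simp [MonoidHom.mem_ker, h]
  refine ⟨(MulEquiv.ofBijective
    ((e.symm.toMonoidHom.comp SemidirectProduct.inl).codRestrict π.ker hmem) ⟨?_, ?_⟩).symm⟩
  · intro y z hyz
    exact SemidirectProduct.inl_injective (e.symm.injective (congrArg Subtype.val hyz))
  · rintro ⟨g, hg⟩
    refine ⟨(e g).left, Subtype.ext (e.injective ?_)⟩
    rw [MonoidHom.mem_ker, h] at hg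
    ext <;> simp [hg]

/-- BS(1,n) is isomorphic to ℤ[1/n] ⋊ ℤ, where c ∈ ℤ acts on ℤ[1/n] by
multiplication by nᶜ, via an isomorphism sending a ↦ (1,0) and t ↦ (0,1); moreover,
the kernel of π : BS(1,n) → ℤ, a ↦ 0, t ↦ 1, is isomorphic to ℤ[1/n]. -/
theorem bs_iso_semidirect (n : ℤ) (hn : n ∉ ({0, 1, -1} : Set ℤ)) (hn0 : n ≠ 0)
    (φ : Multiplicative ℤ →* MulAut (Multiplicative ↥(zSub n hn0)))
    (hφ : ∀ (c : ℤ) (x : ↥(zSub n hn0)),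
      ((((φ (Multiplicative.ofAdd c)) (Multiplicative.ofAdd x)).toAdd : ↥(zSub n hn0)) : ℚ)
        = (n : ℚ) ^ c * (x : ℚ)) :
    (∃ e : BS n ≃* SemidirectProduct (Multiplicative ↥(zSub n hn0)) (Multiplicative ℤ) φ,
      e (BS.a n) =
        SemidirectProduct.inl
          (Multiplicative.ofAdd (⟨1, ⟨1, 0, by norm_num⟩⟩ : ↥(zSub n hn0))) ∧
      e (BS.t n) = SemidirectProduct.inr (Multiplicative.ofAdd (1 : ℤ))) ∧
    (∀ π : BS n →* Multiplicative ℤ,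
      π (BS.a n) = 1 → π (BS.t n) = Multiplicative.ofAdd (1 : ℤ) →
      Nonempty (↥(MonoidHom.ker π) ≃* Multiplicative ↥(zSub n hn0))) := by
  have hone : (1 : ℚ) ∈ zSub n hn0 := ⟨1, 0, by norm_num⟩
  set x : Multiplicative ↥(zSub n hn0) := Multiplicative.ofAdd ⟨1, hone⟩ with hx_def
  have hxk (k : ℤ) : (((x ^ k).toAdd : ↥(zSub n hn0)) : ℚ) = k := by
    simp [hx_def]
  have hx : φ (Multiplicative.ofAdd 1) x = x ^ n := by
    apply Multiplicative.toAdd.injective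
    apply Subtype.ext
    rw [hxk, hx_def, hφ]
    simp
  have hinj : Function.Injective (bsToSemidirect n φ x hx) := by
    refine bsToSemidirect_injective n φ x hx fun k hk => ?_
    have h := hxk k
    rw [hk, toAdd_one, ZeroMemClass.coe_zero] at h
    exact_mod_cast h.symm
  have hsurj : Function.Surjective (bsToSemidirect n φ x hx) := by
    refine bsToSemidirect_surjective n φ x hx fun y => ?_
    obtain ⟨k, p, hy⟩ := y.toAdd.2
    refine ⟨p, k, ?_⟩
    apply Multiplicative.toAdd.injective
    apply Subtype.ext
    rw [← ofAdd_toAdd (x ^ k), hφ, hxk, hy, zpow_neg, zpow_natCast, div_eq_inv_mul]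
  let e := MulEquiv.ofBijective (bsToSemidirect n φ x hx) ⟨hinj, hsurj⟩
  refine ⟨⟨e, bsToSemidirect_a n φ x hx, bsToSemidirect_t n φ x hx⟩, fun π ha ht => ?_⟩
  refine SemidirectProduct.nonempty_ker_mulEquiv e π fun g => ?_
  have hπ : π = SemidirectProduct.rightHom.comp (bsToSemidirect n φ x hx) := by
    refine PresentedGroup.ext fun b => ?_
    cases b
    · change π (BS.a n) = SemidirectProduct.rightHom (bsToSemidirect n φ x hx (BS.a n))
      simp [ha]
    · change π (BS.t n) = SemidirectProduct.rightHom (bsToSemidirect n φ x hx (BS.t n))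
      simp [ht]
  rw [hπ]
  rfl
end

section
/- For every integer n with n ∉ {0, 1, -1} and all α, β ∈ ℤ[1/n], there exists a group endomorphism of BS(1,n) sending a to aᵅ and t to aᵝ t (i.e., this assignment on generators preserves the defining relation t⁻¹ aⁿ t = a, since (aᵝt)⁻¹ (aᵅ)ⁿ (aᵝt) = aᵅ). -/
theorem BS.t_mul_a_zpow_mul_t_inv (n k : ℤ) :
    BS.t n * BS.a n ^ k * (BS.t n)⁻¹ = BS.a n ^ (n * k) := by
  have h : (BS.t n)⁻¹ * BS.a n ^ n * BS.t n * (BS.a n)⁻¹ = 1 :=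
    PresentedGroup.one_of_mem (rels := bsRels n) rfl
  have h' : BS.t n * BS.a n * (BS.t n)⁻¹ = BS.a n ^ n := by
    conv_lhs => rw [← mul_inv_eq_one.mp h]
    group
  rw [← conj_zpow, h', zpow_mul]

theorem BS.t_pow_mul_a_zpow_mul_t_pow_inv (n k : ℤ) (j : ℕ) :
    BS.t n ^ j * BS.a n ^ k * (BS.t n ^ j)⁻¹ = BS.a n ^ (n ^ j * k) := by
  induction j with
  | zero => simp
  | succ j ih =>
    calc BS.t n ^ (j + 1) * BS.a n ^ k * (BS.t n ^ (j + 1))⁻¹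
        = BS.t n * (BS.t n ^ j * BS.a n ^ k * (BS.t n ^ j)⁻¹) * (BS.t n)⁻¹ := by
          rw [pow_succ']; simp only [mul_inv_rev, mul_assoc]
      _ = BS.a n ^ (n ^ (j + 1) * k) := by
          rw [ih, BS.t_mul_a_zpow_mul_t_inv, pow_succ', mul_assoc]

theorem apow_eq_conj (n : ℤ) {α : ℚ} (hα : α ∈ zInv n) :
    ∃ (k : ℤ) (p : ℕ), apow n α = (BS.t n ^ p)⁻¹ * BS.a n ^ k * BS.t n ^ p := by
  obtain ⟨k, p, h⟩ := hα
  have h' : ∃ kp : ℤ × ℕ, α = (kp.1 : ℚ) / (n : ℚ) ^ kp.2 := ⟨(k, p), h⟩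
  refine ⟨h'.choose.1, h'.choose.2, ?_⟩
  rw [apow, dif_pos h', zpow_neg, zpow_natCast]

theorem commute_apow (n : ℤ) {α β : ℚ} (hα : α ∈ zInv n) (hβ : β ∈ zInv n) :
    Commute (apow n α) (apow n β) := by
  obtain ⟨k, p, hA⟩ := apow_eq_conj n hα
  obtain ⟨l, q, hB⟩ := apow_eq_conj n hβ
  have hA' : BS.t n ^ (q + p) * apow n α * (BS.t n ^ (q + p))⁻¹ = BS.a n ^ (n ^ q * k) := by
    rw [hA, ← BS.t_pow_mul_a_zpow_mul_t_pow_inv, pow_add]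
    group
  have hB' : BS.t n ^ (q + p) * apow n β * (BS.t n ^ (q + p))⁻¹ = BS.a n ^ (n ^ p * l) := by
    rw [hB, ← BS.t_pow_mul_a_zpow_mul_t_pow_inv, add_comm, pow_add]
    group
  rw [← Commute.conj_iff (BS.t n ^ (q + p)), hA', hB']
  exact Commute.zpow_zpow_self _ _ _

theorem t_inv_mul_apow_zpow_mul_t (n : ℤ) {α : ℚ} (hα : α ∈ zInv n) :
    (BS.t n)⁻¹ * apow n α ^ n * BS.t n = apow n α := by
  obtain ⟨k, p, hA⟩ := apow_eq_conj n hα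
  have h : apow n α ^ n = (BS.t n ^ p)⁻¹ * BS.a n ^ (n * k) * BS.t n ^ p := by
    have := conj_zpow (i := n) (a := (BS.t n ^ p)⁻¹) (b := BS.a n ^ k)
    rw [inv_inv] at this
    rw [hA, this, ← zpow_mul, mul_comm]
  rw [h, ← BS.t_mul_a_zpow_mul_t_inv, hA]
  group

/-- for α, β ∈ ℤ[1/n] there is an endomorphism of BS(1,n)
sending a ↦ a^α and t ↦ a^β t (the type-I endomorphism ψ^I_{α,β}). -/
theorem exists_typeI_endo (n : ℤ) (hn : n ∉ ({0, 1, -1} : Set ℤ))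
    (α β : ℚ) (hα : α ∈ zInv n) (hβ : β ∈ zInv n) :
    ∃ ψ : BS n →* BS n, ψ (BS.a n) = apow n α ∧ ψ (BS.t n) = apow n β * BS.t n := by
  have hrel : ∀ r ∈ bsRels n,
      FreeGroup.lift (fun b => bif b then apow n β * BS.t n else apow n α) r = 1 := by
    rintro _ rfl
    have hc : (apow n β)⁻¹ * apow n α ^ n * apow n β = apow n α ^ n := by
      rw [mul_assoc, ((commute_apow n hα hβ).zpow_left n).eq, inv_mul_cancel_left]
    simp only [map_mul, map_inv, map_zpow, FreeGroup.lift_apply_of, cond_true, cond_false]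
    rw [mul_inv_eq_one]
    calc (apow n β * BS.t n)⁻¹ * apow n α ^ n * (apow n β * BS.t n)
        = (BS.t n)⁻¹ * ((apow n β)⁻¹ * apow n α ^ n * apow n β) * BS.t n := by
          simp only [mul_inv_rev, mul_assoc]
      _ = apow n α := by rw [hc, t_inv_mul_apow_zpow_mul_t n hα]
  exact ⟨PresentedGroup.toGroup hrel, PresentedGroup.toGroup.of hrel,
    PresentedGroup.toGroup.of hrel⟩
end

section
/- For all α₁, β₁, α₂, β₂ ∈ ℤ[1/n], the composite endomorphism of BS(1,n) obtained by first applying ψ^I_{α₁,β₁} and then applying ψ^I_{α₂,β₂} equals ψ^I_{α₁α₂, β₁α₂+β₂}. -/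
theorem BS.conj_a_zpow (n : ℤ) (k : ℤ) :
    (BS.t n)⁻¹ * BS.a n ^ (k * n) * BS.t n = BS.a n ^ k := by
  have hrel : (BS.t n)⁻¹ * BS.a n ^ n * BS.t n = BS.a n := by
    have h : PresentedGroup.mk (bsRels n) ((FreeGroup.of true)⁻¹ * (FreeGroup.of false) ^ n *
        FreeGroup.of true * (FreeGroup.of false)⁻¹) = 1 :=
      PresentedGroup.one_of_mem (Set.mem_singleton _)
    simp only [map_mul, map_inv, map_zpow] at h
    exact mul_inv_eq_one.mp h
  have hconj := conj_zpow (i := k) (a := (BS.t n)⁻¹) (b := BS.a n ^ n)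
  rw [inv_inv, hrel, ← zpow_mul, mul_comm n k] at hconj
  exact hconj.symm

theorem BS.conj_pow_a_zpow (n : ℤ) (k : ℤ) (q : ℕ) :
    (BS.t n ^ q)⁻¹ * BS.a n ^ (k * n ^ q) * BS.t n ^ q = BS.a n ^ k := by
  induction q with
  | zero => simp
  | succ q ih =>
    rw [← ih, ← BS.conj_a_zpow n (k * n ^ q), pow_succ' (BS.t n), pow_succ n, ← mul_assoc k]
    group

/-- Expanding the fraction `k / n ^ p` by `n ^ q` does not change the element it represents. -/
theorem BS.conj_pow_expand (n : ℤ) (k : ℤ) (p q : ℕ) :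
    (BS.t n ^ (q + p))⁻¹ * BS.a n ^ (k * n ^ q) * BS.t n ^ (q + p) =
      (BS.t n ^ p)⁻¹ * BS.a n ^ k * BS.t n ^ p := by
  rw [← BS.conj_pow_a_zpow n k q, pow_add]
  group

theorem apow_div {n : ℤ} (hn : n ≠ 0) (k : ℤ) (p : ℕ) :
    apow n ((k : ℚ) / (n : ℚ) ^ p) = (BS.t n ^ p)⁻¹ * BS.a n ^ k * BS.t n ^ p := by
  have h : ∃ kp : ℤ × ℕ, (k : ℚ) / (n : ℚ) ^ p = (kp.1 : ℚ) / (n : ℚ) ^ kp.2 := ⟨(k, p), rfl⟩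
  have hn' : (n : ℚ) ≠ 0 := Int.cast_ne_zero.mpr hn
  have hc := h.choose_spec
  rw [apow, dif_pos h, zpow_neg, zpow_natCast]
  generalize h.choose = lq at hc
  obtain ⟨l, q⟩ := lq
  rw [div_eq_div_iff (pow_ne_zero _ hn') (pow_ne_zero _ hn')] at hc
  have hc' : k * n ^ q = l * n ^ p := by exact_mod_cast hc
  rw [← BS.conj_pow_expand n k p q, ← BS.conj_pow_expand n l q p, hc', add_comm p q]

theorem exists_common_denominator {n : ℤ} (hn : n ≠ 0) {α β : ℚ} (hα : α ∈ zInv n)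
    (hβ : β ∈ zInv n) :
    ∃ (k l : ℤ) (p : ℕ), α = (k : ℚ) / (n : ℚ) ^ p ∧ β = (l : ℚ) / (n : ℚ) ^ p := by
  obtain ⟨k, p, rfl⟩ := hα
  obtain ⟨l, q, rfl⟩ := hβ
  have hn' : (n : ℚ) ≠ 0 := Int.cast_ne_zero.mpr hn
  refine ⟨k * n ^ q, l * n ^ p, p + q, ?_, ?_⟩ <;> push_cast <;> field_simp <;> ring

theorem apow_add {n : ℤ} (hn : n ≠ 0) {α β : ℚ} (hα : α ∈ zInv n) (hβ : β ∈ zInv n) :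
    apow n (α + β) = apow n α * apow n β := by
  obtain ⟨k, l, p, rfl, rfl⟩ := exists_common_denominator hn hα hβ
  rw [← add_div, ← Int.cast_add, apow_div hn, apow_div hn, apow_div hn, zpow_add]
  group

theorem apow_zpow {n : ℤ} (hn : n ≠ 0) {α : ℚ} (hα : α ∈ zInv n) (m : ℤ) :
    apow n α ^ m = apow n (m * α) := by
  obtain ⟨k, p, rfl⟩ := hα
  have hconj := conj_zpow (i := m) (a := (BS.t n ^ p)⁻¹) (b := BS.a n ^ k)
  rw [inv_inv] at hconj
  rw [← mul_div_assoc, ← Int.cast_mul, apow_div hn, apow_div hn, hconj, ← zpow_mul, mul_comm k m]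

theorem mul_mem_zInv {n : ℤ} {α β : ℚ} (hα : α ∈ zInv n) (hβ : β ∈ zInv n) :
    α * β ∈ zInv n := by
  obtain ⟨k, p, rfl⟩ := hα
  obtain ⟨l, q, rfl⟩ := hβ
  exact ⟨k * l, p + q, by rw [div_mul_div_comm, pow_add, Int.cast_mul]⟩

theorem intCast_mem_zInv (n m : ℤ) : (m : ℚ) ∈ zInv n := ⟨m, 0, by simp⟩

theorem div_pow_mem_zInv {n : ℤ} {α : ℚ} (hα : α ∈ zInv n) (p : ℕ) :
    α / (n : ℚ) ^ p ∈ zInv n := by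
  obtain ⟨k, q, rfl⟩ := hα
  exact ⟨k, q + p, by rw [div_div, pow_add]⟩

/-- The element `a^β t` acts on the `a^α` by conjugation in the same way as `t`. -/
theorem conj_apow {n : ℤ} (hn : n ≠ 0) {α β : ℚ} (hα : α ∈ zInv n) (hβ : β ∈ zInv n) :
    (apow n β * BS.t n)⁻¹ * apow n α * (apow n β * BS.t n) = apow n (α / n) := by
  have hcomm : apow n α * apow n β = apow n β * apow n α := by
    rw [← apow_add hn hα hβ, ← apow_add hn hβ hα, add_comm]
  have hdiv : (BS.t n)⁻¹ * apow n α * BS.t n = apow n (α / n) := by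
    obtain ⟨k, p, rfl⟩ := hα
    rw [div_div, ← pow_succ, apow_div hn, apow_div hn, pow_succ]
    group
  calc
    _ = (BS.t n)⁻¹ * ((apow n β)⁻¹ * (apow n α * apow n β)) * BS.t n := by group
    _ = _ := by rw [hcomm, inv_mul_cancel_left, hdiv]

theorem conj_pow_apow {n : ℤ} (hn : n ≠ 0) {α β : ℚ} (hα : α ∈ zInv n) (hβ : β ∈ zInv n)
    (p : ℕ) :
    ((apow n β * BS.t n) ^ p)⁻¹ * apow n α * (apow n β * BS.t n) ^ p =
      apow n (α / (n : ℚ) ^ p) := by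
  induction p with
  | zero => simp
  | succ p ih =>
    rw [pow_succ (n : ℚ), ← div_div, ← conj_apow hn (div_pow_mem_zInv hα p) hβ, ← ih,
      pow_succ (apow n β * BS.t n)]
    group

/-- A type-I endomorphism with `a ↦ a^α` sends `a^γ` to `a^(γα)`. -/
theorem typeI_map_apow {n : ℤ} (hn : n ≠ 0) {α β γ : ℚ} (hα : α ∈ zInv n) (hβ : β ∈ zInv n)
    (hγ : γ ∈ zInv n) (ψ : BS n →* BS n) (ha : ψ (BS.a n) = apow n α)
    (ht : ψ (BS.t n) = apow n β * BS.t n) : ψ (apow n γ) = apow n (γ * α) := by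
  obtain ⟨k, p, rfl⟩ := hγ
  rw [apow_div hn, map_mul, map_mul, map_inv, map_pow, map_zpow, ha, ht, apow_zpow hn hα,
    conj_pow_apow hn (mul_mem_zInv (intCast_mem_zInv n k) hα) hβ, div_mul_eq_mul_div]

/-- the composite of the type-I endomorphisms ψ^I_{α₁,β₁} followed by
ψ^I_{α₂,β₂} is ψ^I_{α₁α₂, β₁α₂+β₂} (endomorphisms are determined by their values on a, t). -/
theorem comp_typeI_typeI (n : ℤ) (hn : n ∉ ({0, 1, -1} : Set ℤ))
    (α₁ β₁ α₂ β₂ : ℚ) (hα₁ : α₁ ∈ zInv n) (hβ₁ : β₁ ∈ zInv n)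
    (hα₂ : α₂ ∈ zInv n) (hβ₂ : β₂ ∈ zInv n)
    (ψ₁ ψ₂ : BS n →* BS n)
    (h₁a : ψ₁ (BS.a n) = apow n α₁) (h₁t : ψ₁ (BS.t n) = apow n β₁ * BS.t n)
    (h₂a : ψ₂ (BS.a n) = apow n α₂) (h₂t : ψ₂ (BS.t n) = apow n β₂ * BS.t n) :
    (ψ₂.comp ψ₁) (BS.a n) = apow n (α₁ * α₂) ∧
    (ψ₂.comp ψ₁) (BS.t n) = apow n (β₁ * α₂ + β₂) * BS.t n := by
  have hn0 : n ≠ 0 := fun h => hn (by simp [h])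
  constructor
  · rw [MonoidHom.comp_apply, h₁a, typeI_map_apow hn0 hα₂ hβ₂ hα₁ ψ₂ h₂a h₂t]
  · rw [MonoidHom.comp_apply, h₁t, map_mul, typeI_map_apow hn0 hα₂ hβ₂ hβ₁ ψ₂ h₂a h₂t, h₂t,
      apow_add hn0 (mul_mem_zInv hβ₁ hα₂) hβ₂, mul_assoc]
end

section
/- Let n be an integer with n ∉ {0, 1, -1}, let m, r, ℓ, q ∈ ℤ with 0 ≤ r ≤ q, and set ν = m/n^r ∈ ℤ[1/n], β = ℓ/n^q ∈ ℤ[1/n]. Let u = aᵛ and v = aᵝ t in BS(1,n), let ψ be the endomorphism of BS(1,n) determined by a ↦ u a u⁻¹ and t ↦ v, let z = u⁻¹ v u, and let φ_z be the endomorphism of BS(1,n) determined by a ↦ a and t ↦ z. Then there exist w ∈ BS(1,n) and α ∈ ℤ[1/n] with u⁻¹ = φ_z(w)⁻¹ · aᵅ · w if and only if there exists g ∈ BS(1,n) such that ψ(g⁻¹ a g) = g⁻¹ a g (i.e., the conjugacy class of a meets the fixed-point set of ψ). -/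
lemma BS.t_mul_a_zpow_s19 (n k : ℤ) :
    BS.t n * BS.a n ^ k = BS.a n ^ (k * n) * BS.t n := by
  have h : (BS.t n)⁻¹ * BS.a n ^ n * BS.t n * (BS.a n)⁻¹ = 1 :=
    PresentedGroup.one_of_mem (rels := bsRels n) rfl
  have h₁ : BS.a n = (BS.t n)⁻¹ * BS.a n ^ n * (BS.t n)⁻¹⁻¹ := by
    rw [inv_inv]
    exact (mul_inv_eq_one.mp h).symm
  have h₂ : BS.a n ^ k = (BS.t n)⁻¹ * BS.a n ^ (k * n) * (BS.t n)⁻¹⁻¹ := by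
    rw [mul_comm k n, zpow_mul, ← conj_zpow, ← h₁]
  rw [h₂]
  group

lemma BS.t_pow_mul_a_zpow_s19 (n k : ℤ) (p : ℕ) :
    BS.t n ^ p * BS.a n ^ k = BS.a n ^ (k * n ^ p) * BS.t n ^ p := by
  induction p with
  | zero => simp
  | succ p ih =>
    rw [pow_succ', mul_assoc, ih, ← mul_assoc, BS.t_mul_a_zpow_s19, mul_assoc, mul_assoc, pow_succ]

lemma BS.a_zpow_mul_t_pow_inv_s19 (n k : ℤ) (p : ℕ) :
    BS.a n ^ k * (BS.t n ^ p)⁻¹ = (BS.t n ^ p)⁻¹ * BS.a n ^ (k * n ^ p) := by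
  rw [eq_inv_mul_iff_mul_eq, ← mul_assoc, BS.t_pow_mul_a_zpow_s19, mul_inv_cancel_right]

/-- Every element of `BS(1,n)` has the form `t⁻ᵖ aᵏ tˢ` with `p ≥ 0`. -/
lemma BS.exists_eq_t_pow_inv_mul_a_zpow_mul_t_zpow (n : ℤ) (x : BS n) :
    ∃ (p : ℕ) (k s : ℤ), x = (BS.t n ^ p)⁻¹ * BS.a n ^ k * BS.t n ^ s := by
  have hx : x ∈ Subgroup.closure (Set.range (PresentedGroup.of (rels := bsRels n))) := by
    rw [PresentedGroup.closure_range_of]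
    exact Subgroup.mem_top x
  have hmul (j k s : ℤ) (p : ℕ) : BS.a n ^ j * ((BS.t n ^ p)⁻¹ * BS.a n ^ k * BS.t n ^ s) =
      (BS.t n ^ p)⁻¹ * BS.a n ^ (j * n ^ p + k) * BS.t n ^ s := by
    rw [← mul_assoc, ← mul_assoc, BS.a_zpow_mul_t_pow_inv_s19, mul_assoc (_)⁻¹, ← zpow_add]
  induction hx using Subgroup.closure_induction_left with
  | one => exact ⟨0, 0, 0, by simp⟩
  | mul_left y hy x _ ih =>
    obtain ⟨p, k, s, rfl⟩ := ih
    obtain ⟨_ | _, rfl⟩ := hy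
    · exact ⟨p, 1 * n ^ p + k, s, by rw [← hmul, zpow_one]; rfl⟩
    · change ∃ p' k' s', BS.t n * _ = _
      cases p with
      | zero =>
        refine ⟨0, k * n, 1 + s, ?_⟩
        simp only [pow_zero, inv_one, one_mul]
        rw [← mul_assoc, BS.t_mul_a_zpow_s19, mul_assoc, zpow_add, zpow_one]
      | succ p => exact ⟨p, k, s, by rw [pow_succ]; group⟩
  | inv_mul_cancel y hy x _ ih =>
    obtain ⟨p, k, s, rfl⟩ := ih
    obtain ⟨_ | _, rfl⟩ := hy
    · exact ⟨p, -1 * n ^ p + k, s, by rw [← hmul, zpow_neg_one]; rfl⟩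
    · change ∃ p' k' s', (BS.t n)⁻¹ * _ = _
      exact ⟨p + 1, k, s, by rw [pow_succ]; group⟩

lemma apow_div_pow (n : ℤ) (hn : n ≠ 0) (k : ℤ) (p : ℕ) :
    apow n ((k : ℚ) / (n : ℚ) ^ p) = (BS.t n ^ p)⁻¹ * BS.a n ^ k * BS.t n ^ p := by
  have h : ∃ kp : ℤ × ℕ, (k : ℚ) / (n : ℚ) ^ p = (kp.1 : ℚ) / (n : ℚ) ^ kp.2 := ⟨(k, p), rfl⟩
  rw [apow, dif_pos h]
  have hc := h.choose_spec
  generalize h.choose = c at hc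
  obtain ⟨k', p'⟩ := c
  have hn' : (n : ℚ) ≠ 0 := by exact_mod_cast hn
  dsimp only at hc ⊢
  rw [div_eq_div_iff (pow_ne_zero _ hn') (pow_ne_zero _ hn')] at hc
  have hc' : k * n ^ p' = k' * n ^ p := by exact_mod_cast hc
  have expand (k : ℤ) (p j : ℕ) : (BS.t n ^ p)⁻¹ * BS.a n ^ k * BS.t n ^ p =
      (BS.t n ^ (j + p))⁻¹ * BS.a n ^ (k * n ^ j) * BS.t n ^ (j + p) := by
    rw [pow_add, mul_inv_rev, mul_assoc _ (_)⁻¹, ← BS.a_zpow_mul_t_pow_inv_s19]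
    group
  rw [zpow_neg, zpow_natCast, expand k p p', expand k' p' p, hc', add_comm]

/-- The action of `BS(1,n)` on `ℚ` by affine maps, `a` translating by `1` and `t` scaling by
`n`. -/
noncomputable def BS.toPerm (n : ℤ) (hn : (n : ℚ) ≠ 0) : BS n →* Equiv.Perm ℚ :=
  PresentedGroup.toGroup
    (f := fun b => if b then Equiv.mulLeft₀ (n : ℚ) hn else Equiv.addRight (1 : ℚ)) (by
      rintro _ rfl
      ext x
      simp only [map_mul, map_inv, map_zpow, FreeGroup.lift_apply_of, if_true, Bool.false_eq_true,
        if_false]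
      simp [Equiv.Perm.mul_apply, Equiv.Perm.inv_def]
      field_simp
      ring)

lemma BS.toPerm_a_zpow_apply (n : ℤ) (hn : (n : ℚ) ≠ 0) (k : ℤ) (x : ℚ) :
    BS.toPerm n hn (BS.a n ^ k) x = x + k := by
  rw [map_zpow]
  simp [BS.toPerm, BS.a]

lemma BS.toPerm_t_zpow_apply (n : ℤ) (hn : (n : ℚ) ≠ 0) (s : ℤ) (x : ℚ) :
    BS.toPerm n hn (BS.t n ^ s) x = (n : ℚ) ^ s * x := by
  have h : BS.toPerm n hn (BS.t n) = MulAction.toPermHom ℚˣ ℚ (Units.mk0 (n : ℚ) hn) := by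
    ext x
    simp [BS.toPerm, BS.t, Units.smul_def]
  rw [map_zpow, h, ← map_zpow]
  simp [Units.smul_def]

lemma BS.commute_a_iff (n : ℤ) (hn : n ∉ ({0, 1, -1} : Set ℤ)) (x : BS n) :
    Commute x (BS.a n) ↔ ∃ α ∈ zInv n, x = apow n α := by
  simp only [Set.mem_insert_iff, Set.mem_singleton_iff, not_or] at hn
  obtain ⟨hn₀, hn₁, hn₂⟩ := hn
  have hn' : (n : ℚ) ≠ 0 := by exact_mod_cast hn₀
  constructor
  · intro hx
    obtain ⟨p, k, s, rfl⟩ := BS.exists_eq_t_pow_inv_mul_a_zpow_mul_t_zpow n x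
    have h (y : ℚ) := congrArg (fun g => BS.toPerm n hn' g y) hx.eq
    have ha := BS.toPerm_a_zpow_apply n hn' 1
    rw [zpow_one] at ha
    simp only [← zpow_natCast, ← zpow_neg, map_mul _ _ (BS.a n), map_mul _ (BS.a n),
      map_mul _ (_ * _) (_ ^ _), map_mul _ (_ ^ _) (_ ^ _), Equiv.Perm.mul_apply, ha,
      BS.toPerm_a_zpow_apply, BS.toPerm_t_zpow_apply] at h
    have h₁ : (n : ℚ) ^ (-(p : ℤ) + s) = 1 := by
      rw [zpow_add₀ hn']
      have := h 0
      push_cast at this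
      linear_combination this
    have hs : s = p := by
      by_contra hne
      have habs : |(n : ℚ)| ^ (-(p : ℤ) + s) = 1 := by rw [← abs_zpow, h₁, abs_one]
      rw [zpow_eq_one_iff_right₀ (abs_nonneg _) ?_] at habs
      · omega
      · intro h
        rcases eq_or_eq_neg_of_abs_eq h with h | h
        · exact hn₁ (by exact_mod_cast h)
        · exact hn₂ (by exact_mod_cast h)
    subst hs
    exact ⟨_, ⟨k, p, rfl⟩, by rw [apow_div_pow n hn₀, zpow_natCast]⟩
  · rintro ⟨_, ⟨k, p, rfl⟩, rfl⟩
    have ha : BS.a n = (BS.t n ^ p)⁻¹ * BS.a n ^ (n ^ p) * (BS.t n ^ p)⁻¹⁻¹ := by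
      have := BS.a_zpow_mul_t_pow_inv_s19 n 1 p
      rw [one_mul, zpow_one] at this
      rw [← this, mul_inv_cancel_right]
    rw [apow_div_pow n hn₀]
    have h := (Commute.conj_iff (BS.t n ^ p)⁻¹).mpr
      (Commute.zpow_zpow_self (BS.a n) k (n ^ p))
    rwa [← ha, inv_inv] at h

/-- with u = a^ν, v = a^β t (ν = m/n^r, β = ℓ/n^q, 0 ≤ r ≤ q),
ψ : a ↦ u a u⁻¹, t ↦ v, z = u⁻¹ v u and φ_z : a ↦ a, t ↦ z, there exist w ∈ BS(1,n)
and α ∈ ℤ[1/n] with u⁻¹ = φ_z(w)⁻¹ · a^α · w iff the conjugacy class of a meets Fix ψ. -/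
theorem outer_fixed_point_iff_twisted (n : ℤ) (hn : n ∉ ({0, 1, -1} : Set ℤ))
    (m l : ℤ) (r q : ℕ) (hrq : r ≤ q)
    (u v z : BS n)
    (hu : u = apow n ((m : ℚ) / (n : ℚ) ^ r))
    (hv : v = apow n ((l : ℚ) / (n : ℚ) ^ q) * BS.t n)
    (hz : z = u⁻¹ * v * u)
    (ψ : BS n →* BS n)
    (hψa : ψ (BS.a n) = u * BS.a n * u⁻¹) (hψt : ψ (BS.t n) = v)
    (φz : BS n →* BS n)
    (hφa : φz (BS.a n) = BS.a n) (hφt : φz (BS.t n) = z) :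
    (∃ w : BS n, ∃ α ∈ zInv n, u⁻¹ = (φz w)⁻¹ * apow n α * w) ↔
    (∃ g : BS n, ψ (g⁻¹ * BS.a n * g) = g⁻¹ * BS.a n * g) := by
  have hψ : ψ = (MulAut.conj u).toMonoidHom.comp φz := by
    refine PresentedGroup.ext fun b => ?_
    cases b
    · change ψ (BS.a n) = u * φz (BS.a n) * u⁻¹
      rw [hψa, hφa]
    · change ψ (BS.t n) = u * φz (BS.t n) * u⁻¹
      rw [hψt, hφt, hz]
      group
  refine exists_congr fun g => ?_
  have hcomm : ψ (g⁻¹ * BS.a n * g) = g⁻¹ * BS.a n * g ↔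
      Commute (φz g * u⁻¹ * g⁻¹) (BS.a n) := by
    have h : ψ (g⁻¹ * BS.a n * g) = u * ((φz g)⁻¹ * BS.a n * φz g) * u⁻¹ := by
      simp [hψ, hφa]
    rw [h, commute_iff_eq]
    constructor <;> intro h
    · have := congrArg (fun y => φz g * u⁻¹ * y * g⁻¹) h
      simpa [mul_assoc] using this.symm
    · have := congrArg (fun y => u * (φz g)⁻¹ * y * g) h
      simpa [mul_assoc] using this.symm
  rw [hcomm, BS.commute_a_iff n hn]
  refine exists_congr fun α => and_congr_right fun _ => ?_
  rw [mul_inv_eq_iff_eq_mul, mul_assoc, eq_inv_mul_iff_mul_eq]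
end
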